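/- Fix a totally real number field K₀ of class number one whose narrow class number is also one, and let 0 < σ < 1. Let φ be an even Schwartz function on ℝ whose Fourier transform φ̂ is supported in (−σ, σ). For each CM-field K with maximal totally real subfield K₀, odd class number h_K, and Δ = Δ_K, define S₁(Δ, φ) = −2 · ∑_{𝔭 non-principal} log N𝔭 · ∑_{m ≥ 1, 𝔭^m principal} φ̂(m·log N𝔭 / log Δ) / N𝔭^{m/2}, where the outer sum runs over the non-principal prime ideals 𝔭 of O_K. Then there exists Δ₀ such that S₁(Δ_K, φ) = 0 for every such CM-field K with Δ_K ≥ Δ₀. -/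

import Mathlib

open NumberField FourierTransform

/-- The sum `S₁(Δ, φ) = −2·∑_{𝔭 non-principal} log N𝔭 · ∑_{m ≥ 1, 𝔭^m principal}
φ̂(m·log N𝔭/log Δ)/N𝔭^{m/2}`, over the non-principal prime ideals of the ring of integers
of `K`. -/
noncomputable def S1.{v} (K : Type v) [Field K] [NumberField K]
    (φ : SchwartzMap ℝ ℂ) (Δ : ℝ) : ℂ :=
  (-2 : ℂ) * ∑' 𝔭 : {𝔭 : Ideal (𝓞 K) // 𝔭.IsPrime ∧ ¬Submodule.IsPrincipal 𝔭},
    (Real.log (Ideal.absNorm 𝔭.1) : ℂ) *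
      ∑' m : {m : ℕ // 1 ≤ m ∧ Submodule.IsPrincipal (𝔭.1 ^ (m : ℕ))},
        𝓕 ⇑φ ((m : ℝ) * Real.log (Ideal.absNorm 𝔭.1) / Real.log Δ) /
          ((((Ideal.absNorm 𝔭.1 : ℝ) ^ (((m : ℕ) : ℝ) / 2)) : ℝ) : ℂ)

/-- `F` has narrow class number one: every nonzero ideal of `O_F` is generated by a totally
positive element. -/
def NarrowClassOne.{u} (F : Type u) [Field F] [NumberField F] : Prop :=
  ∀ I : Ideal (𝓞 F), I ≠ ⊥ →
    ∃ x : 𝓞 F, I = Ideal.span {x} ∧ ∀ ψ : F →+* ℝ, 0 < ψ (x : F)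

section CMExtension

variable {F K : Type*} [Field F] [Field K] [Algebra F K]

/-- In a CM extension `K/F`, there is an `F`-automorphism preserving every infinite absolute value,
whose fixed field is `F`. -/
theorem exists_algEquiv_conj [NumberField K] [IsTotallyReal F] [IsTotallyComplex K]
    [Algebra.IsQuadraticExtension F K] :
    ∃ τ : K ≃ₐ[F] K, (∀ (w : InfinitePlace K) (x : K), w (τ x) = w x) ∧
      ∀ x : K, τ x = x → x ∈ Set.range (algebraMap F K) := by
  have : IsCMField K := IsCMField.ofCMExtension F K
  refine ⟨AlgEquiv.ofRingEquiv (f := (IsCMField.complexConj K).toRingEquiv) fun x ↦ ?_,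
    fun w x ↦ IsCMField.infinitePlace_complexConj K w x, fun x hx ↦ ?_⟩
  · exact IsCMField.complexConj_apply_eq_self K (CMExtension.equivMaximalRealSubfield F K x)
  · refine ⟨(CMExtension.equivMaximalRealSubfield F K).symm
      ⟨x, (IsCMField.complexConj_eq_self_iff K x).mp hx⟩, ?_⟩
    rw [CMExtension.algebraMap_equivMaximalRealSubfield_symm_apply]
    rfl

open Polynomial in
/-- The derivative of the minimal polynomial of a generator of a quadratic extension, evaluated at
that generator. -/
theorem aeval_derivative_minpoly_eq_sub [Algebra.IsQuadraticExtension F K] (τ : K ≃ₐ[F] K)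
    {x : K} (hx : τ x ≠ x) :
    aeval x (derivative (minpoly F x)) = x - τ x := by
  have hint : IsIntegral F x := Algebra.IsIntegral.isIntegral x
  have hdeg : (minpoly F x).natDegree = 2 := by
    have h1 : (minpoly F x).natDegree ∣ 2 :=
      Algebra.IsQuadraticExtension.finrank_eq_two F K ▸ minpoly.degree_dvd hint
    refine ((Nat.dvd_prime Nat.prime_two).mp h1).resolve_left fun h ↦ hx ?_
    obtain ⟨y, rfl⟩ := minpoly.natDegree_eq_one_iff.mp h
    exact τ.commutes y
  have hlead : (minpoly F x).coeff 2 = 1 := hdeg ▸ (minpoly.monic hint).coeff_natDegree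
  have hroot : aeval x (minpoly F x) = 0 := minpoly.aeval F x
  have hroot' : aeval (τ x) (minpoly F x) = 0 := by
    rw [aeval_algHom_apply, hroot, map_zero]
  generalize minpoly F x = f at *
  have hf : f = X ^ 2 + C (f.coeff 1) * X + C (f.coeff 0) := by
    conv_lhs => rw [f.as_sum_range_C_mul_X_pow, hdeg]
    simp [Finset.sum_range_succ, hlead]
    ring
  rw [hf] at hroot hroot' ⊢
  simp at hroot hroot' ⊢
  refine mul_left_cancel₀ (sub_ne_zero.mpr hx) ?_
  linear_combination hroot' - hroot

variable [NumberField F] [NumberField K]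

/-- In a CM extension `K/F`, the absolute discriminant of `K` is bounded in terms of the norm of any
integer of `K` not in `F`. -/
theorem natAbs_discr_le_of_notMem_range [IsTotallyReal F] [IsTotallyComplex K]
    [Algebra.IsQuadraticExtension F K] (x : 𝓞 K) (hx : (x : K) ∉ Set.range (algebraMap F K)) :
    (discr K).natAbs ≤
      4 ^ Module.finrank ℚ F * (discr F).natAbs ^ 2 * Ideal.absNorm (Ideal.span {x}) := by
  obtain ⟨τ, hτ, hfix⟩ := exists_algEquiv_conj (F := F) (K := K)
  have hne : τ x ≠ x := fun h ↦ hx (hfix _ h)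
  have hint : IsIntegral (𝓞 F) x := Algebra.IsIntegral.isIntegral x
  set y : 𝓞 K := Polynomial.aeval x (Polynomial.derivative (minpoly (𝓞 F) x)) with hy
  have hycoe : (y : K) = x - τ x := by
    rw [← aeval_derivative_minpoly_eq_sub τ hne,
      minpoly.isIntegrallyClosed_eq_field_fractions F K hint, Polynomial.derivative_map,
      Polynomial.aeval_map_algebraMap, Polynomial.aeval_algebraMap_apply]
  have hy0 : y ≠ 0 := by
    intro h
    rw [h] at hycoe
    exact hne (sub_eq_zero.mp hycoe.symm).symm
  have htop : Algebra.adjoin F {(algebraMap (𝓞 K) K x)} = ⊤ := by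
    rw [← IntermediateField.adjoin_simple_toSubalgebra_of_isAlgebraic
      (Algebra.IsAlgebraic.isAlgebraic _), ← IntermediateField.top_toSubalgebra]
    congr 1
    have := IntermediateField.isSimpleOrder_of_finrank_prime F K
      (Algebra.IsQuadraticExtension.finrank_eq_two F K ▸ Nat.prime_two)
    refine (eq_bot_or_eq_top _).resolve_left fun h ↦ hx ?_
    rw [IntermediateField.adjoin_simple_eq_bot_iff, IntermediateField.mem_bot] at h
    exact h
  have hmem : y ∈ differentIdeal (𝓞 F) (𝓞 K) :=
    aeval_derivative_mem_differentIdeal (𝓞 F) F K x htop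
  have hdvd : Ideal.absNorm (differentIdeal (𝓞 F) (𝓞 K)) ≤ Ideal.absNorm (Ideal.span {y}) := by
    refine Nat.le_of_dvd (Nat.pos_of_ne_zero ?_) (Ideal.absNorm_dvd_absNorm_of_le
      ((Ideal.span_singleton_le_iff_mem _).mpr hmem))
    rwa [Ne, Ideal.absNorm_eq_zero_iff, Ideal.span_singleton_eq_bot]
  have hnorm (z : 𝓞 K) : (Ideal.absNorm (Ideal.span {z}) : ℝ) =
      ∏ w : InfinitePlace K, w z ^ w.mult := by
    rw [InfinitePlace.prod_eq_abs_norm, Ideal.absNorm_span_singleton,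
      ← Algebra.coe_norm_int, Nat.cast_natAbs]
    push_cast
    rfl
  have hbound : Ideal.absNorm (Ideal.span {y}) ≤
      4 ^ Module.finrank ℚ F * Ideal.absNorm (Ideal.span {x}) := by
    have h4 : (4 : ℝ) ^ Module.finrank ℚ F = ∏ w : InfinitePlace K, 2 ^ w.mult := by
      rw [Finset.prod_pow_eq_pow_sum, InfinitePlace.sum_mult_eq, ← Module.finrank_mul_finrank ℚ F K,
        Algebra.IsQuadraticExtension.finrank_eq_two F K, mul_comm, pow_mul]
      norm_num
    rw [← Nat.cast_le (α := ℝ)]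
    push_cast
    rw [hnorm, hnorm, h4, ← Finset.prod_mul_distrib]
    refine Finset.prod_le_prod (fun w _ ↦ by positivity) fun w _ ↦ ?_
    rw [← mul_pow, hycoe]
    gcongr
    calc w ((x : K) - τ x) ≤ w x + w (τ x) := AbsoluteValue.sub_le_add w.1 _ _
      _ = 2 * w x := by rw [hτ]; ring
  rw [natAbs_discr_eq_absNorm_differentIdeal_mul_natAbs_discr_pow F (𝓞 F) K (𝓞 K),
    Algebra.IsQuadraticExtension.finrank_eq_two F K]
  calc _ ≤ (4 ^ Module.finrank ℚ F * Ideal.absNorm (Ideal.span {x})) * (discr F).natAbs ^ 2 :=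
        Nat.mul_le_mul_right _ (hdvd.trans hbound)
    _ = _ := by ring

/-- If a power of a prime `P` of a quadratic extension of a field of class number one is generated
by an element of the base field, then the square of `P` is principal. -/
theorem isPrincipal_sq_of_pow_eq_span_algebraMap [Algebra.IsQuadraticExtension F K]
    (hcl : classNumber F = 1) {P : Ideal (𝓞 K)} [P.IsPrime] (hP : P ≠ ⊥) {m : ℕ} (hm : m ≠ 0)
    (a : 𝓞 F) (h : P ^ m = Ideal.span {algebraMap (𝓞 F) (𝓞 K) a}) : (P ^ 2).IsPrincipal := by
  have hpid : IsPrincipalIdealRing (𝓞 F) := (classNumber_eq_one_iff).mp hcl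
  set p := P.under (𝓞 F) with hp
  have hpP : P.LiesOver p := ⟨rfl⟩
  have hp0 : p ≠ ⊥ := Ideal.IsIntegral.comap_ne_bot (𝓞 F) hP
  have hprime : Prime p := Ideal.prime_of_isPrime hp0 inferInstance
  have ha : a ∈ p := by
    rw [hp, Ideal.mem_comap]
    exact Ideal.pow_le_self hm (h ▸ Ideal.mem_span_singleton_self _)
  have hdvd : p.map (algebraMap (𝓞 F) (𝓞 K)) ∣ P ^ m := by
    rw [Ideal.dvd_iff_le, h, Ideal.span_singleton_le_iff_mem]
    exact Ideal.mem_map_of_mem _ ha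
  obtain ⟨k, -, hk⟩ := (dvd_prime_pow (Ideal.prime_of_isPrime hP inferInstance) m).mp hdvd
  rw [associated_iff_eq] at hk
  obtain ⟨s, hs⟩ := Ideal.exists_relNorm_eq_pow_of_isPrime P p
  have hnorm := congr_arg (Ideal.relNorm (𝓞 F)) hk
  rw [Ideal.relNorm_algebraMap, map_pow, hs, ← pow_mul,
    ← IsFractionRing.finrank_eq (𝓞 F) F (𝓞 K) K,
    Algebra.IsQuadraticExtension.finrank_eq_two F K] at hnorm
  have hk2 : s * k = 2 := (pow_injective_of_not_isUnit hprime.not_isUnit hprime.ne_zero hnorm).symm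
  have hgen : P ^ k = Ideal.span {algebraMap (𝓞 F) (𝓞 K) (Submodule.IsPrincipal.generator p)} := by
    rw [← hk, ← Set.image_singleton, ← Ideal.map_span, Ideal.span_singleton_generator]
  rw [← hk2, mul_comm, pow_mul, hgen, Ideal.span_singleton_pow]
  exact ⟨_, rfl⟩

/-- In a CM extension `K/F` with `F` of class number one and `K` of odd class number, principal
powers of non-principal primes of `K` have large norm. -/
theorem natAbs_discr_le_of_isPrincipal_pow [IsTotallyReal F] [IsTotallyComplex K]
    [Algebra.IsQuadraticExtension F K] (hcl : classNumber F = 1) (hodd : Odd (classNumber K))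
    {P : Ideal (𝓞 K)} [P.IsPrime] (hP : ¬ P.IsPrincipal) {m : ℕ} (hm : m ≠ 0)
    (h : (P ^ m).IsPrincipal) :
    (discr K).natAbs ≤ 4 ^ Module.finrank ℚ F * (discr F).natAbs ^ 2 * Ideal.absNorm P ^ m := by
  obtain ⟨x, hx⟩ := h
  rw [← map_pow, hx]
  refine natAbs_discr_le_of_notMem_range (F := F) x ?_
  rintro ⟨a, ha⟩
  have hint : IsIntegral ℤ a := by
    rw [← isIntegral_algebraMap_iff (FaithfulSMul.algebraMap_injective F K), ha]
    exact x.isIntegral_coe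
  refine hP (Ideal.IsPrincipal.of_isPrincipal_pow_of_coprime (Nat.coprime_two_left.mpr hodd)
    (isPrincipal_sq_of_pow_eq_span_algebraMap hcl (fun h ↦ hP (h ▸ bot_isPrincipal)) hm
      ⟨a, hint⟩ ?_))
  rw [hx, show algebraMap (𝓞 F) (𝓞 K) ⟨a, hint⟩ = x from RingOfIntegers.ext ha]

end CMExtension

/-- fix a totally real number field `K₀` of class number one whose narrow class
number is also one, `0 < σ < 1`, and an even Schwartz function `φ` with
`supp(φ̂) ⊆ (−σ, σ)`. Then there is a `Δ₀` such that `S₁(Δ_K, φ) = 0` for every CM-field `K`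
with maximal totally real subfield `K₀`, odd class number, and `Δ_K ≥ Δ₀`. -/
theorem stmt_11.{u, v} (K₀ : Type u) [Field K₀] [NumberField K₀]
    (hTR : ∀ ψ : K₀ →+* ℂ, ∀ z : K₀, (ψ z).im = 0)
    (hcl : NumberField.classNumber K₀ = 1)
    (hnarrow : NarrowClassOne K₀)
    (σ : ℝ) (hσ0 : 0 < σ) (hσ1 : σ < 1)
    (φ : SchwartzMap ℝ ℂ) (heven : ∀ x : ℝ, φ (-x) = φ x)
    (hsupp : Function.support (𝓕 ⇑φ) ⊆ Set.Ioo (-σ) σ) :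
    ∃ Δ₀ : ℝ, ∀ (K : Type v) [Field K] [NumberField K] [Algebra K₀ K],
      Module.finrank K₀ K = 2 →
      IsEmpty (K →+* ℝ) →
      Odd (NumberField.classNumber K) →
      Δ₀ ≤ ((NumberField.discr K).natAbs : ℝ) →
      S1 K φ ((NumberField.discr K).natAbs : ℝ) = 0 := by
  have : IsTotallyReal K₀ := ⟨fun v ↦ InfinitePlace.isReal_iff.mpr <| by
    rw [ComplexEmbedding.isReal_iff]
    ext z
    exact Complex.conj_eq_iff_im.mpr (hTR _ z)⟩
  set C : ℝ := 4 ^ Module.finrank ℚ K₀ * ((discr K₀).natAbs : ℝ) ^ 2 with hC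
  have hCpos : 0 < C := by
    have : 0 < (discr K₀).natAbs := Int.natAbs_pos.mpr (discr_ne_zero K₀)
    positivity
  refine ⟨max 2 (Real.exp (Real.log C / (1 - σ))), fun K _ _ _ h2 hreal hodd hΔ ↦ ?_⟩
  have : Algebra.IsQuadraticExtension K₀ K := { finrank_eq_two' := h2 }
  have : IsTotallyComplex K := ⟨fun v ↦ by
    rw [← InfinitePlace.not_isReal_iff_isComplex]
    exact fun hv ↦ hreal.false (InfinitePlace.embedding_of_isReal hv)⟩
  set Δ : ℝ := ((discr K).natAbs : ℝ) with hΔdef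
  have hΔ2 : 2 ≤ Δ := (le_max_left _ _).trans hΔ
  have hlogΔ : 0 < Real.log Δ := Real.log_pos (by linarith)
  have hlogC : Real.log C ≤ (1 - σ) * Real.log Δ := by
    rw [mul_comm, ← div_le_iff₀ (by linarith)]
    exact (Real.le_log_iff_exp_le (by linarith)).mpr ((le_max_right _ _).trans hΔ)
  have hvanish (P : Ideal (𝓞 K)) [P.IsPrime] (hP : ¬ P.IsPrincipal) (m : ℕ) (hm : 1 ≤ m)
      (hPm : (P ^ m).IsPrincipal) :
      𝓕 ⇑φ ((m : ℝ) * Real.log (Ideal.absNorm P) / Real.log Δ) = 0 := by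
    have hle : Δ ≤ C * (Ideal.absNorm P : ℝ) ^ m := by
      rw [hΔdef, hC]
      exact_mod_cast natAbs_discr_le_of_isPrincipal_pow (F := K₀) hcl hodd hP (by lia) hPm
    have hpos : 0 < (Ideal.absNorm P : ℝ) ^ m :=
      pos_of_mul_pos_right (by linarith) hCpos.le
    have hlog := Real.log_le_log (by linarith) hle
    rw [Real.log_mul hCpos.ne' hpos.ne', Real.log_pow] at hlog
    by_contra hne
    have hlt := (hsupp hne).2
    rw [div_lt_iff₀ hlogΔ] at hlt
    linarith
  unfold S1
  rw [mul_eq_zero]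
  right
  refine (tsum_congr fun P ↦ ?_).trans tsum_zero
  have := P.2.1
  rw [mul_eq_zero]
  right
  refine (tsum_congr fun m ↦ ?_).trans tsum_zero
  rw [hvanish P.1 P.2.2 m m.2.1 m.2.2, zero_div]
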